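/- Let p > 3 be a prime. If p ≡ ±5 mod 12 then p does not divide disc(F_{3p}); if p ≡ 11 mod 12 then p divides disc(F_{3p}); and if p ≡ 1 mod 12 then p divides disc(F_{3p}) if and only if 12 is a fourth-power residue modulo p. -/

import Mathlib

open Polynomial

/-- Fekete polynomial of the principal Dirichlet character mod `n`. -/
noncomputable def Fek (n : ℕ) : Polynomial ℤ :=
  ∑ a ∈ Finset.range n, if Nat.gcd a n = 1 then X ^ a else 0

lemma first_sum (n : ℕ) : ∑ a ∈ Finset.range (3 * n), (if a % 3 = 0 then 0 else (X : ℤ[X]) ^ a)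
    = (X ^ 2 + X) * ∑ k ∈ Finset.range n, X ^ (3 * k) := by
  induction n with
  | zero => simp
  | succ k ih =>
    have h1 : (3 * k + 1) % 3 ≠ 0 := by omega
    have h2 : (3 * k + 2) % 3 ≠ 0 := by omega
    rw [show 3 * (k + 1) = 3 * k + 1 + 1 + 1 by ring, Finset.sum_range_succ,
      Finset.sum_range_succ, Finset.sum_range_succ, ih, Finset.sum_range_succ]
    simp only [h1, h2, if_false, Nat.mul_mod_right, if_true]
    ring

lemma gcd_iff {p : ℕ} (hp : p.Prime) (a : ℕ) : Nat.gcd a (3 * p) = 1 ↔ a % 3 ≠ 0 ∧ ¬ p ∣ a := by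
  change Nat.Coprime a (3 * p) ↔ _
  rw [Nat.coprime_mul_iff_right, Nat.coprime_comm, Nat.Prime.coprime_iff_not_dvd Nat.prime_three,
    Nat.coprime_comm, Nat.Prime.coprime_iff_not_dvd hp, Nat.dvd_iff_mod_eq_zero]

lemma Fek_eq {p : ℕ} (hp : p.Prime) (hgt : 3 < p) : Fek (3 * p) =
    (X ^ 2 + X) * ∑ k ∈ Finset.range p, X ^ (3 * k) - (X ^ (2 * p) + X ^ p) := by
  have h3 : ¬ 3 ∣ p := by
    intro h
    have := (Nat.prime_dvd_prime_iff_eq Nat.prime_three hp).1 h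
    omega
  have hs : ∑ a ∈ Finset.range (3 * p), (if a ∈ ({2 * p, p} : Finset ℕ) then (X : ℤ[X]) ^ a else 0)
      = X ^ (2 * p) + X ^ p := by
    rw [Finset.sum_ite_mem, Finset.inter_eq_right.2, Finset.sum_pair (by omega)]
    intro a ha
    simp at ha ⊢
    omega
  rw [← first_sum, ← hs, ← Finset.sum_sub_distrib, Fek]
  refine Finset.sum_congr rfl fun a ha => ?_
  rw [Finset.mem_range] at ha
  have key : a ∈ ({2 * p, p} : Finset ℕ) ↔ a % 3 ≠ 0 ∧ p ∣ a := by
    simp only [Finset.mem_insert, Finset.mem_singleton]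
    constructor
    · rintro (rfl | rfl)
      · exact ⟨by omega, Dvd.intro_left _ rfl⟩
      · exact ⟨by omega, dvd_rfl⟩
    · rintro ⟨h, k, rfl⟩
      have : k < 3 := by
        by_contra hk
        have := Nat.mul_le_mul_left p (not_lt.1 hk)
        omega
      interval_cases k <;> simp_all [mul_comm]
  simp only [gcd_iff hp, key]
  by_cases h : a % 3 = 0 <;> by_cases h' : p ∣ a <;> simp [h, h']

lemma Fek_G {p : ℕ} (hp : p.Prime) (hgt : 3 < p) : (X ^ 3 - 1) * Fek (3 * p) =
    (X ^ 2 + X) * (X ^ (3 * p) - 1) - (X ^ 3 - 1) * (X ^ (2 * p) + X ^ p) := by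
  have := mul_geom_sum ((X : ℤ[X]) ^ 3) p
  simp only [← pow_mul] at this
  rw [Fek_eq hp hgt, ← this]
  ring

lemma Fek_natDegree_monic {p : ℕ} (hp : p.Prime) (hgt : 3 < p) :
    (Fek (3 * p)).Monic ∧ (Fek (3 * p)).natDegree = 3 * p - 1 := by
  have hc : (Fek (3 * p)).coeff (3 * p - 1) = 1 := by
    simp only [Fek, finsetSum_coeff]
    rw [Finset.sum_eq_single (3 * p - 1)]
    · have : Nat.gcd (3 * p - 1) (3 * p) = 1 := by
        rw [gcd_iff hp]
        refine ⟨by omega, fun h => ?_⟩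
        have h2 : p ∣ 1 := by
          have := (Nat.dvd_sub (Dvd.intro_left 3 rfl : p ∣ 3 * p) h)
          rwa [show 3 * p - (3 * p - 1) = 1 by omega] at this
        exact hp.one_lt.ne' (Nat.dvd_one.1 h2)
      simp [this]
    · intro b _ hb
      split_ifs
      · simp [coeff_X_pow, hb.symm]
      · simp
    · intro h
      simp at h
      omega
  have hd : (Fek (3 * p)).natDegree ≤ 3 * p - 1 := by
    refine natDegree_sum_le_of_forall_le _ _ fun a ha => ?_
    rw [Finset.mem_range] at ha
    split_ifs
    · rw [natDegree_X_pow]; omega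
    · simp
  exact ⟨monic_of_natDegree_le_of_coeff_eq_one _ hd hc,
    le_antisymm hd (le_natDegree_of_ne_zero (by simp [hc]))⟩

lemma eq_of_roots {K : Type*} [Field K] (h2 : (2 : K) ≠ 0) (h3 : (3 : K) ≠ 0) (x y : K)
    (hu : x ^ 4 + 2 * x ^ 3 + 2 * x + 1 = 0) (hv : y ^ 4 + 2 * y ^ 3 + 2 * y + 1 = 0)
    (hy : y ^ 3 - 1 ≠ 0)
    (h : (2 * x + 1) * (y ^ 3 - 1) = 3 * x ^ 2 * (y ^ 2 + y)) : y = x := by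
  have e : (3 * (y ^ 3 - 1)) * ((y - x) * (2 * x * y + x + y)) = 0 := by
    linear_combination 3 * y ^ 2 * h + 3 * x ^ 2 * hv
  rcases mul_eq_zero.1 ((mul_eq_zero.1 e).resolve_left (mul_ne_zero h3 hy)) with e | e
  · exact sub_eq_zero.1 e
  exfalso
  have e' : y * (2 * x + 1) = -x := by linear_combination e
  have a1 : x ^ 4 - 2 * x ^ 3 * (2 * x + 1) - 2 * x * (2 * x + 1) ^ 3 + (2 * x + 1) ^ 4 = 0 := by
    have c1 : (y * (2 * x + 1)) ^ 4 + 2 * (y * (2 * x + 1)) ^ 3 * (2 * x + 1)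
      + 2 * (y * (2 * x + 1)) * (2 * x + 1) ^ 3 + (2 * x + 1) ^ 4 = 0 := by
      linear_combination (2 * x + 1) ^ 4 * hv
    rw [e'] at c1
    linear_combination c1
  have a2 : 4 * (3 * x ^ 3 + 3 * x ^ 2 + 3 * x + 1) = 0 := by linear_combination a1 + 3 * hu
  have h4 : (4 : K) ≠ 0 := by
    rw [show (4 : K) = 2 * 2 by norm_num]; exact mul_ne_zero h2 h2
  have a3 := (mul_eq_zero.1 a2).resolve_left h4
  have a4 : 2 * (3 * x ^ 2 - x - 1) = 0 := by
    linear_combination (x + 1) * a3 - 3 * hu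
  have a5 := (mul_eq_zero.1 a4).resolve_left h2
  have a6 : (2 * x + 1) ^ 2 = 0 := by linear_combination a3 - x * a5
  have a7 : 2 * x + 1 = 0 := pow_eq_zero_iff (two_ne_zero) |>.1 a6
  have : (1 : K) = 0 := by linear_combination 4 * a5 - (6 * x - 5) * a7
  exact one_ne_zero this

lemma quartic_iff {K : Type*} [Field K] (h2 : (2 : K) ≠ 0) :
    (∃ x : K, x ^ 4 + 2 * x ^ 3 + 2 * x + 1 = 0) ↔ ∃ a : K, a ^ 4 = 12 := by
  constructor
  · rintro ⟨x, hx⟩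
    have hx0 : x ≠ 0 := by rintro rfl; simp at hx
    refine ⟨x - x⁻¹, ?_⟩
    field_simp
    linear_combination (x ^ 4 - 2 * x ^ 3 - 2 * x + 1) * hx
  · rintro ⟨a, ha⟩
    refine ⟨(-(1 + a ^ 2 / 2) + a) / 2, ?_⟩
    have h : ((-(1 + a ^ 2 / 2) + a) / 2) ^ 2 + (1 + a ^ 2 / 2) * ((-(1 + a ^ 2 / 2) + a) / 2) + 1 = 0 := by
      field_simp
      linear_combination - ha
    have h4 : (a ^ 2 / 2) ^ 2 = 3 := by
      field_simp; linear_combination ha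
    generalize (-(1 + a ^ 2 / 2) + a) / 2 = x at *
    generalize a ^ 2 / 2 = s at *
    linear_combination (x ^ 2 + (1 - s) * x + 1) * h + x ^ 2 * h4

lemma common_root_iff {p : ℕ} [Fact p.Prime] (hgt : 3 < p) {K : Type*} [Field K] [CharP K p]
    (x : K) :
    (((Fek (3 * p)).map (Int.castRingHom K)).eval x = 0 ∧
      (derivative ((Fek (3 * p)).map (Int.castRingHom K))).eval x = 0) ↔
    (x ^ p = x ∧ x ^ 4 + 2 * x ^ 3 + 2 * x + 1 = 0) := by
  have hp : p.Prime := Fact.out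
  have hc : ∀ n : ℕ, 0 < n → n < p → (n : K) ≠ 0 := fun n h0 h1 h => by
    rw [CharP.cast_eq_zero_iff K p] at h
    exact absurd (Nat.le_of_dvd h0 h) (by omega)
  have h2 : (2 : K) ≠ 0 := by exact_mod_cast hc 2 (by omega) (by omega)
  have h3 : (3 : K) ≠ 0 := by exact_mod_cast hc 3 (by omega) (by omega)
  have hpK : (p : K) = 0 := CharP.cast_eq_zero K p
  set f := (Fek (3 * p)).map (Int.castRingHom K) with hf
  have hF : f = (X ^ 2 + X) * ∑ k ∈ Finset.range p, X ^ (3 * k) - (X ^ (2 * p) + X ^ p) := by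
    rw [hf, Fek_eq hp hgt]
    simp [Polynomial.map_sum]
  have hG : (X ^ 3 - 1) * f =
      (X ^ 2 + X) * (X ^ (3 * p) - 1) - (X ^ 3 - 1) * (X ^ (2 * p) + X ^ p) := by
    have := congrArg (Polynomial.map (Int.castRingHom K)) (Fek_G hp hgt)
    simpa using this
  have g0 : (x ^ 3 - 1) * f.eval x =
      (x ^ 2 + x) * ((x ^ p) ^ 3 - 1) - (x ^ 3 - 1) * ((x ^ p) ^ 2 + x ^ p) := by
    have := congrArg (eval x) hG
    simp only [eval_mul, eval_sub, eval_add, eval_pow, eval_X, eval_one] at this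
    rw [this]
    ring
  have g1 : 3 * x ^ 2 * f.eval x + (x ^ 3 - 1) * (derivative f).eval x =
      (2 * x + 1) * ((x ^ p) ^ 3 - 1) - 3 * x ^ 2 * ((x ^ p) ^ 2 + x ^ p) := by
    have := congrArg (fun q => eval x (derivative q)) hG
    simp [derivative_mul, derivative_X_pow] at this
    linear_combination this
  have ycube : (x ^ p) ^ 3 - 1 = (x ^ 3 - 1) ^ p := by
    rw [sub_pow_char, one_pow]; ring
  constructor
  · rintro ⟨e0, e1⟩
    rw [e0, mul_zero] at g0
    rw [e0, e1, mul_zero, mul_zero, zero_add] at g1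
    have hx : x ^ 3 - 1 ≠ 0 := by
      intro h
      have h' : x ^ 3 = 1 := sub_eq_zero.1 h
      have hz : (x ^ 2 + x) ^ p = 0 := by
        rw [hF] at e0
        simp [eval_finsetSum, pow_mul, h'] at e0
        rw [add_pow_char]
        linear_combination -e0
      have hz := pow_eq_zero_iff hp.ne_zero |>.1 hz
      have h1 : x - 1 = 0 := by linear_combination h - (x - 1) * hz
      have : (2 : K) = 0 := by linear_combination hz - (x + 2) * h1
      exact h2 this
    have hy : (x ^ p) ^ 3 - 1 ≠ 0 := by rw [ycube]; exact pow_ne_zero _ hx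
    have hu : x ^ 4 + 2 * x ^ 3 + 2 * x + 1 = 0 := by
      have : ((x ^ p) ^ 3 - 1) * (x ^ 4 + 2 * x ^ 3 + 2 * x + 1) = 0 := by
        linear_combination (x ^ 3 - 1) * g1 - 3 * x ^ 2 * g0
      exact (mul_eq_zero.1 this).resolve_left hy
    have hv : (x ^ p) ^ 4 + 2 * (x ^ p) ^ 3 + 2 * x ^ p + 1 = 0 := by
      have := congrArg (frobenius K p) hu
      simp only [map_add, map_mul, map_pow, map_one, map_zero, map_ofNat, frobenius_def] at this
      exact this
    exact ⟨eq_of_roots h2 h3 x (x ^ p) hu hv hy (by linear_combination -g1), hu⟩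
  · rintro ⟨hx, hu⟩
    rw [hx] at g0 g1
    have hx3 : x ^ 3 - 1 ≠ 0 := by
      intro h
      have a : x = -1 := by
        have : 3 * (x + 1) = 0 := by linear_combination hu - (x + 2) * h
        exact eq_neg_of_add_eq_zero_left ((mul_eq_zero.1 this).resolve_left h3)
      rw [a] at h
      apply h2
      linear_combination -h
    have e0 : f.eval x = 0 := by
      have : (x ^ 3 - 1) * f.eval x = 0 := by rw [g0]; ring
      exact (mul_eq_zero.1 this).resolve_left hx3
    refine ⟨e0, ?_⟩
    rw [e0] at g1
    have : (x ^ 3 - 1) * (derivative f).eval x = 0 := by linear_combination g1 - hu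
    exact (mul_eq_zero.1 this).resolve_left hx3

lemma dvd_iff {p : ℕ} [Fact p.Prime] (hgt : 3 < p) (D : ℤ)
    (hD : (D : ℂ) = (-1 : ℂ) ^ ((3 * p - 1) * (3 * p - 2) / 2) *
      ((((Fek (3 * p)).map (Int.castRingHom ℂ)).roots).map
        (fun z => (derivative ((Fek (3 * p)).map (Int.castRingHom ℂ))).eval z)).prod) :
    (p : ℤ) ∣ D ↔ ∃ a : ZMod p, a ^ 4 = 12 := by
  have hp : p.Prime := Fact.out
  obtain ⟨hm, hd⟩ := Fek_natDegree_monic hp hgt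
  set f := Fek (3 * p) with hf
  have hR : D = (-1) ^ ((3 * p - 1) * (3 * p - 2) / 2) *
      resultant f (derivative f) (3 * p - 1) (3 * p - 2) := by
    have h1 := resultant_eq_prod_eval (f.map (Int.castRingHom ℂ))
      (derivative (f.map (Int.castRingHom ℂ))) (3 * p - 2)
      ((natDegree_derivative_le _).trans (by rw [hm.natDegree_map, hd]; omega))
      (IsAlgClosed.splits _)
    rw [(hm.map _).leadingCoeff, one_pow, one_mul, hm.natDegree_map, hd, derivative_map,
      resultant_map_map] at h1
    rw [derivative_map] at hD
    have h2 : (D : ℂ) = ((-1) ^ ((3 * p - 1) * (3 * p - 2) / 2) *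
      resultant f (derivative f) (3 * p - 1) (3 * p - 2) : ℤ) := by
      rw [hD]
      push_cast
      congr 1
      exact h1.symm
    exact_mod_cast h2
  set g := f.map (Int.castRingHom (ZMod p)) with hg
  have hgm : g.Monic := hm.map _
  have hgd : g.natDegree = 3 * p - 1 := by rw [hg, hm.natDegree_map, hd]
  have hg'd : (derivative g).natDegree = 3 * p - 2 := by
    apply le_antisymm ((natDegree_derivative_le _).trans (by rw [hgd]; omega))
    apply le_natDegree_of_ne_zero
    rw [coeff_derivative, show 3 * p - 2 + 1 = 3 * p - 1 by omega, ← hgd, hgm.coeff_natDegree,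
      one_mul]
    have : (((3 * p - 2 : ℕ) : ZMod p) + 1) = -1 := by
      rw [Nat.cast_sub (by omega)]
      push_cast
      simp
      norm_num
    rw [this]
    simp
  have hDz : (D : ZMod p) = (-1) ^ ((3 * p - 1) * (3 * p - 2) / 2) *
      resultant g (derivative g) := by
    rw [hgd, hg'd, hg, derivative_map, resultant_map_map, hR]
    push_cast
    rfl
  rw [← ZMod.intCast_zmod_eq_zero_iff_dvd, hDz, mul_eq_zero,
    or_iff_right (pow_ne_zero _ (neg_ne_zero.2 one_ne_zero)), resultant_eq_zero_iff,
    and_iff_right (Or.inl hgm.ne_zero)]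
  refine (not_congr (Polynomial.isCoprime_iff_aeval_ne_zero_of_isAlgClosed
    (ZMod p) (AlgebraicClosure (ZMod p)) g (derivative g))).trans ?_
  have h2 : (2 : ZMod p) ≠ 0 := by
    intro h
    have h : ((2 : ℕ) : ZMod p) = 0 := by exact_mod_cast h
    rw [CharP.cast_eq_zero_iff (ZMod p) p] at h
    exact absurd (Nat.le_of_dvd (by omega) h) (by omega)
  have : CharP (AlgebraicClosure (ZMod p)) p := charP_of_injective_algebraMap
    (algebraMap (ZMod p) (AlgebraicClosure (ZMod p))).injective p
  rw [← quartic_iff h2]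
  have ha2 : algebraMap (ZMod p) (AlgebraicClosure (ZMod p)) 2 = 2 := map_ofNat _ 2
  have key : ∀ x : AlgebraicClosure (ZMod p), (aeval x g = 0 ∧ aeval x (derivative g) = 0) ↔
      (x ^ p = x ∧ x ^ 4 + 2 * x ^ 3 + 2 * x + 1 = 0) := by
    intro x
    have hmm : g.map (algebraMap (ZMod p) (AlgebraicClosure (ZMod p))) =
        f.map (Int.castRingHom _) := by
      rw [hg, Polynomial.map_map]
      congr 1
    rw [← common_root_iff hgt x, ← hf, ← hmm, derivative_map g, eval_map_algebraMap,
      eval_map_algebraMap]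
  constructor
  · intro h
    push Not at h
    obtain ⟨x, hx⟩ := h
    obtain ⟨hxp, hu⟩ := (key x).1 hx
    obtain ⟨n, rfl⟩ : ∃ n : ZMod p, algebraMap (ZMod p) (AlgebraicClosure (ZMod p)) n = x := by
      have := (Subfield.mem_bot_iff_pow_eq_self (AlgebraicClosure (ZMod p)) p).2 hxp
      rw [mem_bot_iff_intCast p] at this
      obtain ⟨n, hn⟩ := this
      exact ⟨n, by simpa using hn⟩
    refine ⟨n, (algebraMap (ZMod p) (AlgebraicClosure (ZMod p))).injective ?_⟩
    simpa [ha2] using hu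
  · rintro ⟨x, hx⟩ h
    have := (key (algebraMap _ _ x)).2 ⟨by rw [← map_pow, ZMod.pow_card], by
      have := congrArg (algebraMap (ZMod p) (AlgebraicClosure (ZMod p))) hx
      simpa [ha2] using this⟩
    rcases h (algebraMap _ _ x) with h | h
    · exact h this.1
    · exact h this.2

lemma not_square_two : ¬ IsSquare ((2 : ℕ) : ZMod 3) := by
  rintro ⟨r, hr⟩
  revert r
  decide

/-- `D` plays the role of the discriminant of the monic polynomial `F_{3p}`:
for a monic polynomial `f` of degree `n`, `disc f = (-1)^(n(n-1)/2) · ∏ f'(rᵢ)`,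
the product ranging over the complex roots of `f`. -/
theorem stmt19 (p : ℕ) (hp : p.Prime) (hgt : 3 < p)
    (D : ℤ)
    (hD : (D : ℂ) = (-1 : ℂ) ^ ((3 * p - 1) * (3 * p - 2) / 2) *
      ((((Fek (3 * p)).map (Int.castRingHom ℂ)).roots).map
        (fun z => (derivative ((Fek (3 * p)).map (Int.castRingHom ℂ))).eval z)).prod) :
    (p % 12 = 5 ∨ p % 12 = 7 → ¬ (p : ℤ) ∣ D) ∧
    (p % 12 = 11 → (p : ℤ) ∣ D) ∧
    (p % 12 = 1 → ((p : ℤ) ∣ D ↔ ∃ a : ZMod p, a ^ 4 = 12)) := by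
  have : Fact p.Prime := ⟨hp⟩
  have : Fact (Nat.Prime 3) := ⟨Nat.prime_three⟩
  have h2 : (2 : ZMod p) ≠ 0 := by
    intro h
    have h : ((2 : ℕ) : ZMod p) = 0 := by exact_mod_cast h
    rw [CharP.cast_eq_zero_iff (ZMod p) p] at h
    exact absurd (Nat.le_of_dvd (by omega) h) (by omega)
  have hmod : ((p : ℕ) : ZMod 3) = ((p % 3 : ℕ) : ZMod 3) := by simp
  have ns : ¬ IsSquare ((2 : ℕ) : ZMod 3) := not_square_two
  have sq1 : IsSquare ((1 : ℕ) : ZMod 3) := ⟨1, by simp⟩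
  refine ⟨fun h hdvd => ?_, fun h => ?_, fun _ => dvd_iff hgt D hD⟩
  · obtain ⟨a, ha⟩ := (dvd_iff hgt D hD).1 hdvd
    have h3 : IsSquare ((3 : ℕ) : ZMod p) := by
      refine ⟨a ^ 2 / 2, ?_⟩
      push_cast
      field_simp
      linear_combination - ha
    rcases h with h | h
    · rw [ZMod.exists_sq_eq_prime_iff_of_mod_four_eq_one (by omega) (by norm_num), hmod,
        show p % 3 = 2 by omega] at h3
      exact ns h3
    · rw [ZMod.exists_sq_eq_prime_iff_of_mod_four_eq_three (by omega) (by norm_num) (by omega),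
        hmod, show p % 3 = 1 by omega] at h3
      exact h3 sq1
  · rw [dvd_iff hgt D hD]
    have h3 : IsSquare ((3 : ℕ) : ZMod p) := by
      rw [ZMod.exists_sq_eq_prime_iff_of_mod_four_eq_three (by omega) (by norm_num) (by omega),
        hmod, show p % 3 = 2 by omega]
      exact ns
    obtain ⟨s, hs⟩ := h3
    push_cast at hs
    have hn : ¬ IsSquare (-1 : ZMod p) := by
      rw [ZMod.exists_sq_eq_neg_one_iff]
      omega
    by_cases hsq : IsSquare (2 * s)
    · obtain ⟨a, ha⟩ := hsq
      exact ⟨a, by linear_combination -(a * a + 2 * s) * ha - 4 * hs⟩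
    · have hq : IsSquare (-1 * (2 * s)) := by
        have a1 := quadraticChar_neg_one_iff_not_isSquare.2 hn
        have a2 := quadraticChar_neg_one_iff_not_isSquare.2 hsq
        have a3 : quadraticChar (ZMod p) (-1 * (2 * s)) = 1 := by
          rw [map_mul, a1, a2]; norm_num
        by_contra hc
        have a4 := quadraticChar_neg_one_iff_not_isSquare.2 hc
        rw [a3] at a4
        norm_num at a4
      obtain ⟨a, ha⟩ := hq
      exact ⟨a, by linear_combination -(a * a - 2 * s) * ha - 4 * hs⟩
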